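/- Let Ψ = {A_1, …, A_m} be a finite set of nonnegative n×n matrices, at least one of which is nonzero, and let r ≥ 0. Then C_{Ψ,r} is nonempty if and only if r > 0 and r ≥ μ̂(Ψ). -/

import Mathlib

open Filter Relation

namespace MaxAlg

/-- Max-algebraic action of a matrix on a vector: `(A ⊗ x) i = max_j A i j * x j`. -/
noncomputable def maxVec {n : ℕ} (A : Fin n → Fin n → ℝ) (x : Fin n → ℝ) : Fin n → ℝ :=
  fun i => ⨆ j, A i j * x j

/-- Max-algebraic matrix product: `(A ⊗ B) i k = max_j A i j * B j k`. -/
noncomputable def maxMul {n : ℕ} (A B : Fin n → Fin n → ℝ) : Fin n → Fin n → ℝ :=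
  fun i k => ⨆ j, A i j * B j k

/-- The weight of the cycle determined by a list `[i₁, …, i_k]`,
namely `A i₁ i₂ * ⋯ * A i_{k-1} i_k * A i_k i₁`. -/
noncomputable def cycleProd {n : ℕ} (A : Fin n → Fin n → ℝ) (l : List (Fin n)) : ℝ :=
  ((l.zip (l.rotate 1)).map fun p => A p.1 p.2).prod

/-- The maximal cycle geometric mean of `A`: the supremum over all cycles of distinct
nodes of the k-th root of the cycle weight. -/
noncomputable def mu {n : ℕ} (A : Fin n → Fin n → ℝ) : ℝ :=
  sSup {c | ∃ l : List (Fin n), l ≠ [] ∧ l.Nodup ∧ c = cycleProd A l ^ ((l.length : ℝ)⁻¹)}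

/-- `C_{A,r}`: the positive vectors with `A ⊗ x ≤ r x`. -/
def Cset {n : ℕ} (A : Fin n → Fin n → ℝ) (r : ℝ) : Set (Fin n → ℝ) :=
  {x | (∀ i, 0 < x i) ∧ ∀ i, maxVec A x i ≤ r * x i}

/-- A critical cycle: a cycle of distinct nodes attaining `mu A`. -/
def IsCriticalCycle {n : ℕ} (A : Fin n → Fin n → ℝ) (l : List (Fin n)) : Prop :=
  l ≠ [] ∧ l.Nodup ∧ cycleProd A l ^ ((l.length : ℝ)⁻¹) = mu A

/-- `(i,j) ∈ E^C(A)`: the edge `(i,j)` lies on some critical cycle. -/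
def criticalEdge {n : ℕ} (A : Fin n → Fin n → ℝ) (i j : Fin n) : Prop :=
  ∃ l : List (Fin n), IsCriticalCycle A l ∧ (i, j) ∈ l.zip (l.rotate 1)

/-- `i ∈ N^C(A)`: the node `i` lies on some critical cycle. -/
def criticalNode {n : ℕ} (A : Fin n → Fin n → ℝ) (i : Fin n) : Prop :=
  ∃ l : List (Fin n), IsCriticalCycle A l ∧ i ∈ l

/-- Irreducibility: the digraph of `A` (edge `(i,j)` iff `A i j > 0`) is strongly connected. -/
def Irred {n : ℕ} (A : Fin n → Fin n → ℝ) : Prop :=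
  ∀ i j, Relation.ReflTransGen (fun a b => 0 < A a b) i j

/-- Max-algebraic product of a word of matrices from the family `A`. -/
noncomputable def wordProd {n m : ℕ} (A : Fin m → Fin n → Fin n → ℝ) :
    List (Fin m) → (Fin n → Fin n → ℝ)
  | [] => fun i j => if i = j then 1 else 0
  | [j] => A j
  | j :: k :: w => maxMul (A j) (wordProd A (k :: w))

/-- The max version of the generalised spectral radius
`μ̂(Ψ) = limsup_{p→∞} (max_{ψ ∈ Ψ^p_⊗} μ(ψ))^{1/p}`. -/
noncomputable def genSpecRad {n m : ℕ} (A : Fin m → Fin n → Fin n → ℝ) : ℝ :=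
  Filter.limsup
    (fun p : ℕ =>
      (sSup {c | ∃ w : List (Fin m), w.length = p ∧ c = mu (wordProd A w)}) ^ ((p : ℝ)⁻¹))
    Filter.atTop

/-- `S = A₁ ⊕ ⋯ ⊕ A_m`: the entrywise maximum of the family. -/
noncomputable def Smat {n m : ℕ} (A : Fin m → Fin n → Fin n → ℝ) : Fin n → Fin n → ℝ :=
  fun i j => ⨆ k, A k i j

/-- The relative error function `e_A(x) = max_{i,j} A i j * x j / x i`. -/
noncomputable def errF {n : ℕ} (A : Fin n → Fin n → ℝ) (x : Fin n → ℝ) : ℝ :=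
  ⨆ i, ⨆ j, A i j * x j / x i

/-- A symmetrically reciprocal (SR) matrix: positive, with unit diagonal and
`A i j * A j i = 1` for `i ≠ j`. -/
def IsSR {n : ℕ} (A : Fin n → Fin n → ℝ) : Prop :=
  (∀ i j, 0 < A i j) ∧ (∀ i, A i i = 1) ∧ ∀ i j, i ≠ j → A i j * A j i = 1

/-- Max-algebraic matrix powers. -/
noncomputable def maxPow {n : ℕ} (B : Fin n → Fin n → ℝ) : ℕ → (Fin n → Fin n → ℝ)
  | 0 => fun i j => if i = j then 1 else 0
  | p + 1 => maxMul B (maxPow B p)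

/-- The Kleene star `B* = I ⊕ B ⊕ B⊗² ⊕ ⋯ ⊕ B⊗^{n-1}`. -/
noncomputable def kleeneStar {n : ℕ} (B : Fin n → Fin n → ℝ) : Fin n → Fin n → ℝ :=
  fun i j => ⨆ p : Fin n, maxPow B p i j

theorem le_maxMul {n : ℕ} (A B : Fin n → Fin n → ℝ) (i j k : Fin n) :
    A i j * B j k ≤ maxMul A B i k :=
  le_ciSup (f := fun j => A i j * B j k) (Set.finite_range _).bddAbove j

theorem mul_le_of_mem_Cset {n : ℕ} {A : Fin n → Fin n → ℝ} {r : ℝ} {x : Fin n → ℝ}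
    (hx : x ∈ Cset A r) (i j : Fin n) : A i j * x j ≤ r * x i :=
  (le_ciSup (f := fun j => A i j * x j) (Set.finite_range _).bddAbove j).trans (hx.2 i)

theorem wordProd_nonneg {n m : ℕ} {A : Fin m → Fin n → Fin n → ℝ}
    (hA : ∀ k i j, 0 ≤ A k i j) (w : List (Fin m)) (i j : Fin n) : 0 ≤ wordProd A w i j := by
  induction w generalizing i j with
  | nil => simp only [wordProd]; split_ifs <;> norm_num
  | cons k w ih =>
    cases w with
    | nil => exact hA k i j
    | cons l w => exact Real.iSup_nonneg fun a => mul_nonneg (hA k i a) (ih a j)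

theorem mul_wordProd_le {n m : ℕ} {A : Fin m → Fin n → Fin n → ℝ}
    (hA : ∀ k i j, 0 ≤ A k i j) (k : Fin m) (w : List (Fin m)) (i j l : Fin n) :
    A k i j * wordProd A w j l ≤ wordProd A (k :: w) i l := by
  cases w with
  | nil =>
    simp only [wordProd]
    split_ifs with h
    · simp [h]
    · simpa using hA k i l
  | cons a w => exact le_maxMul _ _ i j l

theorem wordProd_mul_le {n m : ℕ} {A : Fin m → Fin n → Fin n → ℝ}
    (hA : ∀ k i j, 0 ≤ A k i j) {r : ℝ} (hr : 0 ≤ r) {x : Fin n → ℝ} (hx : ∀ i, 0 < x i)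
    (h : ∀ k i j, A k i j * x j ≤ r * x i) (w : List (Fin m)) (i j : Fin n) :
    wordProd A w i j * x j ≤ r ^ w.length * x i := by
  induction w generalizing i j with
  | nil =>
    simp only [wordProd]
    split_ifs with hij
    · simp [hij]
    · simpa using (hx i).le
  | cons k w ih =>
    cases w with
    | nil => simpa [wordProd] using h k i j
    | cons l w =>
      have : Nonempty (Fin n) := ⟨i⟩
      rw [← le_div_iff₀ (hx j)]
      refine ciSup_le fun a => ?_
      rw [le_div_iff₀ (hx j)]
      calc A k i a * wordProd A (l :: w) a j * x j
          = A k i a * (wordProd A (l :: w) a j * x j) := by ring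
        _ ≤ A k i a * (r ^ (l :: w).length * x a) :=
          mul_le_mul_of_nonneg_left (ih a j) (hA k i a)
        _ = r ^ (l :: w).length * (A k i a * x a) := by ring
        _ ≤ r ^ (l :: w).length * (r * x i) :=
          mul_le_mul_of_nonneg_left (h k i a) (pow_nonneg hr _)
        _ = r ^ (k :: l :: w).length * x i := by simp [pow_succ]; ring

theorem prod_zip_mul_le {n : ℕ} {B : Fin n → Fin n → ℝ} (hB : ∀ i j, 0 ≤ B i j) {s : ℝ}
    (hs : 0 ≤ s) {x : Fin n → ℝ} (hx : ∀ i, 0 < x i) (h : ∀ i j, B i j * x j ≤ s * x i) :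
    ∀ l l' : List (Fin n), l.length = l'.length →
      ((l.zip l').map fun p => B p.1 p.2).prod * (l'.map x).prod
        ≤ s ^ l.length * (l.map x).prod
  | [], [], _ => by simp
  | [], _ :: _, e => by simp at e
  | _ :: _, [], e => by simp at e
  | a :: l, b :: l', e => by
    have ih := prod_zip_mul_le hB hs hx h l l' (by simpa using e)
    have hpos : 0 ≤ ((l.zip l').map fun p => B p.1 p.2).prod * (l'.map x).prod := by
      refine mul_nonneg (List.prod_nonneg ?_) (List.prod_nonneg ?_)
      · intro y hy
        obtain ⟨p, -, rfl⟩ := List.mem_map.1 hy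
        exact hB _ _
      · intro y hy
        obtain ⟨p, -, rfl⟩ := List.mem_map.1 hy
        exact (hx p).le
    have := mul_le_mul (h a b) ih hpos (mul_nonneg hs (hx a).le)
    simp only [List.zip_cons_cons, List.map_cons, List.prod_cons, List.length_cons, pow_succ]
    linarith

theorem cycleProd_le {n : ℕ} {B : Fin n → Fin n → ℝ} (hB : ∀ i j, 0 ≤ B i j) {s : ℝ}
    (hs : 0 ≤ s) {x : Fin n → ℝ} (hx : ∀ i, 0 < x i) (h : ∀ i j, B i j * x j ≤ s * x i)
    (l : List (Fin n)) : cycleProd B l ≤ s ^ l.length := by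
  have key := prod_zip_mul_le hB hs hx h l (l.rotate 1) (by simp)
  have hrot : ((l.rotate 1).map x).prod = (l.map x).prod :=
    ((List.rotate_perm l 1).map x).prod_eq
  have hpos : 0 < (l.map x).prod := by
    refine List.prod_pos ?_
    intro y hy
    obtain ⟨p, -, rfl⟩ := List.mem_map.1 hy
    exact hx p
  rw [hrot] at key
  exact le_of_mul_le_mul_right key hpos

theorem cycleProd_nonneg {n : ℕ} {B : Fin n → Fin n → ℝ} (hB : ∀ i j, 0 ≤ B i j)
    (l : List (Fin n)) : 0 ≤ cycleProd B l := by
  refine List.prod_nonneg ?_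
  intro y hy
  obtain ⟨p, -, rfl⟩ := List.mem_map.1 hy
  exact hB _ _

theorem mu_nonneg {n : ℕ} {B : Fin n → Fin n → ℝ} (hB : ∀ i j, 0 ≤ B i j) : 0 ≤ mu B := by
  refine Real.sSup_nonneg ?_
  rintro _ ⟨l, -, -, rfl⟩
  exact Real.rpow_nonneg (cycleProd_nonneg hB l) _

theorem mu_le {n : ℕ} {B : Fin n → Fin n → ℝ} (hB : ∀ i j, 0 ≤ B i j) {s : ℝ}
    (hs : 0 ≤ s) {x : Fin n → ℝ} (hx : ∀ i, 0 < x i) (h : ∀ i j, B i j * x j ≤ s * x i) :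
    mu B ≤ s := by
  refine Real.sSup_le ?_ hs
  rintro _ ⟨l, hl, -, rfl⟩
  have hl' : l.length ≠ 0 := by simpa using hl
  calc cycleProd B l ^ ((l.length : ℝ)⁻¹) ≤ (s ^ l.length) ^ ((l.length : ℝ)⁻¹) :=
        Real.rpow_le_rpow (cycleProd_nonneg hB l) (cycleProd_le hB hs hx h l) (by positivity)
    _ = s := Real.pow_rpow_inv_natCast hs hl'

theorem finite_setOf_nodup (n : ℕ) : {l : List (Fin n) | l.Nodup}.Finite :=
  (List.finite_length_le (Fin n) n).subset fun l hl => by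
    simpa using List.Nodup.length_le_card hl

theorem diag_le_mu {n : ℕ} (B : Fin n → Fin n → ℝ) (i : Fin n) : B i i ≤ mu B := by
  refine le_csSup (Set.Finite.bddAbove ?_) ⟨[i], by simp, by simp, by simp [cycleProd]⟩
  refine ((finite_setOf_nodup n).image
    fun l => cycleProd B l ^ ((l.length : ℝ)⁻¹)).subset ?_
  rintro _ ⟨l, -, hl, rfl⟩
  exact ⟨l, hl, rfl⟩

/-- The maximal cycle mean over all products of words of length `p`. -/
noncomputable def maxMu {n m : ℕ} (A : Fin m → Fin n → Fin n → ℝ) (p : ℕ) : ℝ :=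
  sSup {c | ∃ w : List (Fin m), w.length = p ∧ c = mu (wordProd A w)}

theorem maxMu_nonneg {n m : ℕ} {A : Fin m → Fin n → Fin n → ℝ}
    (hA : ∀ k i j, 0 ≤ A k i j) (p : ℕ) : 0 ≤ maxMu A p := by
  refine Real.sSup_nonneg ?_
  rintro _ ⟨w, -, rfl⟩
  exact mu_nonneg (wordProd_nonneg hA w)

theorem mu_wordProd_le_maxMu {n m : ℕ} (A : Fin m → Fin n → Fin n → ℝ) (w : List (Fin m)) :
    mu (wordProd A w) ≤ maxMu A w.length := by
  refine le_csSup (Set.Finite.bddAbove ?_) ⟨w, rfl, rfl⟩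
  refine ((List.finite_length_eq (Fin m) w.length).image fun w => mu (wordProd A w)).subset ?_
  rintro _ ⟨v, hv, rfl⟩
  exact ⟨v, hv, rfl⟩

theorem maxMu_rpow_le {n m : ℕ} {A : Fin m → Fin n → Fin n → ℝ}
    (hA : ∀ k i j, 0 ≤ A k i j) {r : ℝ} (hr : 0 ≤ r) {x : Fin n → ℝ} (hx : ∀ i, 0 < x i)
    (h : ∀ k i j, A k i j * x j ≤ r * x i) {p : ℕ} (hp : p ≠ 0) :
    maxMu A p ^ ((p : ℝ)⁻¹) ≤ r := by
  have hle : maxMu A p ≤ r ^ p := by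
    refine Real.sSup_le ?_ (pow_nonneg hr _)
    rintro _ ⟨w, rfl, rfl⟩
    exact mu_le (wordProd_nonneg hA w) (pow_nonneg hr _) hx (wordProd_mul_le hA hr hx h w)
  calc maxMu A p ^ ((p : ℝ)⁻¹) ≤ (r ^ p) ^ ((p : ℝ)⁻¹) :=
        Real.rpow_le_rpow (maxMu_nonneg hA p) hle (by positivity)
    _ = r := Real.pow_rpow_inv_natCast hr hp

theorem genSpecRad_le {n m : ℕ} {A : Fin m → Fin n → Fin n → ℝ}
    (hA : ∀ k i j, 0 ≤ A k i j) {r : ℝ} (hr : 0 ≤ r) {x : Fin n → ℝ} (hx : ∀ i, 0 < x i)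
    (h : ∀ k i j, A k i j * x j ≤ r * x i) : genSpecRad A ≤ r := by
  refine Filter.limsup_le_of_le ?_ ?_
  · refine IsCoboundedUnder.of_frequently_ge (a := 0) (Frequently.of_forall fun p => ?_)
    exact Real.rpow_nonneg (maxMu_nonneg hA p) _
  · filter_upwards [eventually_ne_atTop 0] with p hp
    exact maxMu_rpow_le hA hr hx h hp

theorem le_genSpecRad_of_frequently {n m : ℕ} {A : Fin m → Fin n → Fin n → ℝ}
    (hA : ∀ k i j, 0 ≤ A k i j) {c : ℝ}
    (h : ∃ᶠ p : ℕ in atTop, c ≤ maxMu A p ^ ((p : ℝ)⁻¹)) : c ≤ genSpecRad A := by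
  refine Filter.le_limsup_of_frequently_le h ?_
  obtain ⟨M, hM⟩ := (Set.finite_range
    fun t : Fin m × Fin n × Fin n => A t.1 t.2.1 t.2.2).bddAbove
  refine ⟨max M 0, ?_⟩
  rw [eventually_map]
  filter_upwards [eventually_ne_atTop 0] with p hp
  refine maxMu_rpow_le hA (le_max_right _ _) (x := fun _ => 1) (fun _ => one_pos) ?_ hp
  intro k i j
  simpa using Or.inl (hM ⟨(k, i, j), rfl⟩)

/-- The weight of the walk starting at the given node and visiting the listed nodes in order. -/
def walkWeight {α : Type*} (B : α → α → ℝ) : α → List α → ℝ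
  | _, [] => 1
  | i, j :: l => B i j * walkWeight B j l

/-- The labels along the walk starting at the given node and visiting the listed nodes. -/
def walkWord {α β : Type*} (c : α → α → β) : α → List α → List β
  | _, [] => []
  | i, j :: l => c i j :: walkWord c j l

theorem length_walkWord {α β : Type*} (c : α → α → β) (i : α) (l : List α) :
    (walkWord c i l).length = l.length := by
  induction l generalizing i with
  | nil => rfl
  | cons j l ih => simp [walkWord, ih]

theorem walkWeight_nonneg {α : Type*} {B : α → α → ℝ} (hB : ∀ i j, 0 ≤ B i j) (i : α)
    (l : List α) : 0 ≤ walkWeight B i l := by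
  induction l generalizing i with
  | nil => exact zero_le_one
  | cons j l ih => exact mul_nonneg (hB i j) (ih j)

theorem walkWeight_append {α : Type*} (B : α → α → ℝ) (i : α) (l l' : List α) :
    walkWeight B i (l ++ l') = walkWeight B i l * walkWeight B (l.getLastD i) l' := by
  induction l generalizing i with
  | nil => simp [walkWeight]
  | cons j l ih => simp only [List.cons_append, walkWeight, ih, List.getLastD_cons, mul_assoc]

theorem walkWeight_div {α : Type*} (B : α → α → ℝ) (r : ℝ) (i : α) (l : List α) :
    walkWeight (fun i j => B i j / r) i l = walkWeight B i l / r ^ l.length := by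
  induction l generalizing i with
  | nil => simp [walkWeight]
  | cons j l ih => simp only [walkWeight, ih, List.length_cons, pow_succ']; ring

theorem getLastD_flatten_replicate {α : Type*} {i : α} {l : List α} (h : l.getLastD i = i)
    (N : ℕ) : ((List.replicate N l).flatten).getLastD i = i := by
  induction N with
  | zero => rfl
  | succ N ih =>
    cases hl : (List.replicate N l).flatten with
    | nil => simpa [List.replicate_succ, hl] using h
    | cons a t =>
      rw [hl] at ih
      simp only [List.replicate_succ, List.flatten_cons, hl, List.getLastD_eq_getLast?,
        List.getLast?_append_cons] at ih ⊢
      exact ih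

theorem walkWeight_flatten_replicate {α : Type*} (B : α → α → ℝ) {i : α} {l : List α}
    (h : l.getLastD i = i) (N : ℕ) :
    walkWeight B i (List.replicate N l).flatten = walkWeight B i l ^ N := by
  induction N with
  | zero => simp [walkWeight]
  | succ N ih =>
    rw [List.replicate_succ, List.flatten_cons, walkWeight_append, h, ih, pow_succ']

theorem walkWeight_le_wordProd {n m : ℕ} {A : Fin m → Fin n → Fin n → ℝ}
    (hA : ∀ k i j, 0 ≤ A k i j) (c : Fin n → Fin n → Fin m) (i : Fin n) (l : List (Fin n)) :
    walkWeight (fun i j => A (c i j) i j) i l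
      ≤ wordProd A (walkWord c i l) i (l.getLastD i) := by
  induction l generalizing i with
  | nil => simp [walkWeight, walkWord, wordProd]
  | cons j l ih =>
    rw [List.getLastD_cons]
    exact (mul_le_mul_of_nonneg_left (ih j) (hA _ i j)).trans (mul_wordProd_le hA _ _ i j _)

/-- The weight of a closed walk is at most the corresponding power of the max generalised
spectral radius. -/
theorem walkWeight_le_genSpecRad_pow {n m : ℕ} {A : Fin m → Fin n → Fin n → ℝ}
    (hA : ∀ k i j, 0 ≤ A k i j) (c : Fin n → Fin n → Fin m) {i : Fin n} {l : List (Fin n)}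
    (hl : l ≠ []) (h : l.getLastD i = i) :
    walkWeight (fun i j => A (c i j) i j) i l ≤ genSpecRad A ^ l.length := by
  set w := walkWeight (fun i j => A (c i j) i j) i l with hw
  have hlen : l.length ≠ 0 := by simpa using hl
  have hw0 : 0 ≤ w := walkWeight_nonneg (fun i j => hA _ i j) i l
  set ρ := w ^ ((l.length : ℝ)⁻¹) with hρ
  have hρ0 : 0 ≤ ρ := Real.rpow_nonneg hw0 _
  have hρw : ρ ^ l.length = w := Real.rpow_inv_natCast_pow hw0 hlen
  rw [← hρw]
  refine pow_le_pow_left₀ hρ0 (le_genSpecRad_of_frequently hA ?_) _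
  rw [frequently_atTop]
  intro N
  have hp : l.length * (N + 1) ≠ 0 := mul_ne_zero hlen N.succ_ne_zero
  refine ⟨l.length * (N + 1), ?_, ?_⟩
  · exact N.le_succ.trans (Nat.le_mul_of_pos_left _ (Nat.pos_of_ne_zero hlen))
  have hle : ρ ^ (l.length * (N + 1)) ≤ maxMu A (l.length * (N + 1)) := by
    have h1 := walkWeight_le_wordProd hA c i (List.replicate (N + 1) l).flatten
    rw [walkWeight_flatten_replicate _ h, getLastD_flatten_replicate h, ← hw, ← hρw,
      ← pow_mul] at h1
    have h2 := (h1.trans (diag_le_mu _ i)).trans (mu_wordProd_le_maxMu A _)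
    rw [length_walkWord] at h2
    simpa [mul_comm] using h2
  calc ρ = (ρ ^ (l.length * (N + 1))) ^ (((l.length * (N + 1) : ℕ) : ℝ)⁻¹) :=
        (Real.pow_rpow_inv_natCast hρ0 hp).symm
    _ ≤ _ := Real.rpow_le_rpow (pow_nonneg hρ0 _) hle (by positivity)

/-- If no closed walk has weight exceeding `1`, there is a positive max-algebraic
subeigenvector for the value `1`. -/
theorem exists_pos_subeigenvector {n : ℕ} {B : Fin n → Fin n → ℝ} (hB : ∀ i j, 0 ≤ B i j)
    (h : ∀ i l, l ≠ [] → l.getLastD i = i → walkWeight B i l ≤ 1) :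
    ∃ x : Fin n → ℝ, (∀ i, 0 < x i) ∧ ∀ i j, B i j * x j ≤ x i := by
  have hmax : ∀ i, ∃ l : List (Fin n), (i :: l).Nodup ∧
      ∀ l', (i :: l').Nodup → walkWeight B i l' ≤ walkWeight B i l := by
    intro i
    have hfin : {l : List (Fin n) | (i :: l).Nodup}.Finite :=
      (finite_setOf_nodup n).subset fun l hl => (List.nodup_cons.1 hl).2
    obtain ⟨l, hl, hmax⟩ := Set.exists_max_image _ (walkWeight B i) hfin ⟨[], by simp⟩
    exact ⟨l, hl, hmax⟩
  choose L hL hLmax using hmax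
  refine ⟨fun i => walkWeight B i (L i), fun i => ?_, fun i j => ?_⟩
  · exact one_pos.trans_le (hLmax i [] (by simp))
  · change walkWeight B i (j :: L j) ≤ _
    by_cases hi : i ∈ j :: L j
    · obtain ⟨a, b, hab⟩ := List.append_of_mem hi
      have hnd := hL j
      rw [hab] at hnd ⊢
      have hsplit : a ++ i :: b = (a ++ [i]) ++ b := by simp
      rw [hsplit, walkWeight_append]
      have hlast : (a ++ [i]).getLastD i = i := by simp
      rw [hlast]
      calc walkWeight B i (a ++ [i]) * walkWeight B i b ≤ 1 * walkWeight B i b :=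
            mul_le_mul_of_nonneg_right (h i _ (by simp) hlast) (walkWeight_nonneg hB i b)
        _ = walkWeight B i b := one_mul _
        _ ≤ _ := hLmax i b (hnd.sublist (List.sublist_append_right a _))
    · exact hLmax i _ (List.nodup_cons.2 ⟨hi, hL j⟩)

/-- `C_{Ψ,r}` is nonempty iff `r > 0` and `r ≥ μ̂(Ψ)`. -/
theorem stmt4 {n m : ℕ} (hm : 0 < m) (A : Fin m → Fin n → Fin n → ℝ)
    (hA : ∀ k i j, 0 ≤ A k i j) (h0 : ∃ k, A k ≠ 0) (r : ℝ) (hr : 0 ≤ r) :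
    (⋂ k, Cset (A k) r).Nonempty ↔ 0 < r ∧ genSpecRad A ≤ r := by
  have : Nonempty (Fin m) := ⟨⟨0, hm⟩⟩
  constructor
  · rintro ⟨x, hx⟩
    rw [Set.mem_iInter] at hx
    have hpos := (hx ⟨0, hm⟩).1
    have hle : ∀ k i j, A k i j * x j ≤ r * x i := fun k => mul_le_of_mem_Cset (hx k)
    refine ⟨?_, genSpecRad_le hA hr hpos hle⟩
    obtain ⟨k, hk⟩ := h0
    obtain ⟨i, hi⟩ := Function.ne_iff.1 hk
    obtain ⟨j, hj⟩ := Function.ne_iff.1 hi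
    have hAk : 0 < A k i j := lt_of_le_of_ne (hA k i j) (Ne.symm hj)
    exact pos_of_mul_pos_left ((mul_pos hAk (hpos j)).trans_le (hle k i j)) (hpos i).le
  · rintro ⟨hr0, hrle⟩
    have hmax : ∀ i j, ∃ k, ∀ k', A k' i j ≤ A k i j :=
      fun i j => Finite.exists_max fun k => A k i j
    choose c hc using hmax
    have hG : 0 ≤ genSpecRad A := le_genSpecRad_of_frequently hA
      (Frequently.of_forall fun p => Real.rpow_nonneg (maxMu_nonneg hA p) _)
    obtain ⟨x, hx, hBx⟩ := exists_pos_subeigenvector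
      (B := fun i j => A (c i j) i j / r) (fun i j => div_nonneg (hA _ i j) hr) (by
        intro i l hl h
        rw [walkWeight_div (fun i j => A (c i j) i j), div_le_one (pow_pos hr0 _)]
        exact (walkWeight_le_genSpecRad_pow hA c hl h).trans (pow_le_pow_left₀ hG hrle _))
    refine ⟨x, Set.mem_iInter.2 fun k => ⟨hx, fun i => ?_⟩⟩
    have : Nonempty (Fin n) := ⟨i⟩
    refine ciSup_le fun j => ?_
    have h1 := hBx i j
    rw [div_mul_eq_mul_div, div_le_iff₀ hr0] at h1
    have h2 := mul_le_mul_of_nonneg_right (hc i j k) (hx j).le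
    linarith

end MaxAlg
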